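/- arXiv:1108.0105 — 5 statements merged into one kernel-verified Lean document; each statement's English description precedes it below -/
import Mathlib

section
/- Suppose that for every natural number m ≥ 3 one has 2m/(3 log m) < π(m) < 8m/(5 log m). Then for every natural number n ≥ 5, π(π(n)) > 4n / (9 · log n · (log n − log(log n) − log 1.5)). -/
open Nat Real

/-- Suppose that for every natural number `m ≥ 3` one has
`2m/(3 log m) < π(m) < 8m/(5 log m)`. Then for every natural number `n ≥ 5`,
`π(π(n)) > 4n / (9 · log n · (log n − log(log n) − log 1.5))`. -/
theorem pi_pi_lower_bound
    (h : ∀ m : ℕ, 3 ≤ m →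
      2 * (m : ℝ) / (3 * Real.log m) < Nat.primeCounting m ∧
      (Nat.primeCounting m : ℝ) < 8 * (m : ℝ) / (5 * Real.log m)) :
    ∀ n : ℕ, 5 ≤ n →
      (Nat.primeCounting (Nat.primeCounting n) : ℝ) >
        4 * (n : ℝ) /
          (9 * Real.log n * (Real.log n - Real.log (Real.log n) - Real.log 1.5)) := by
  intro n hn
  have hp3 : 3 ≤ Nat.primeCounting n :=
    le_trans (by decide : 3 ≤ Nat.primeCounting 5) (Nat.monotone_primeCounting hn)
  have hpp2 : 2 ≤ Nat.primeCounting (Nat.primeCounting n) :=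
    le_trans (by decide : 2 ≤ Nat.primeCounting 3) (Nat.monotone_primeCounting hp3)
  have hnR : (5 : ℝ) ≤ n := by exact_mod_cast hn
  have hn0 : (0 : ℝ) < n := by linarith
  have hl : 0 < Real.log n := Real.log_pos (by linarith)
  obtain ⟨y, hy⟩ : ∃ y : ℝ, y = 2 * (n : ℝ) / (3 * Real.log n) := ⟨_, rfl⟩
  have hlogy : Real.log y = Real.log n - Real.log (Real.log n) - Real.log 1.5 := by
    have : y = (n : ℝ) / Real.log n / 1.5 := by
      rw [hy]; field_simp; norm_num
    rw [this, Real.log_div (by positivity) (by norm_num), Real.log_div hn0.ne' hl.ne']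
  have hL2 := Real.log_two_lt_d9
  have hL2' := Real.log_two_gt_d9
  have hlogn : Real.log n ≤ n / 5 + 0.64 := by
    have h1 : (n : ℝ) = 2 * 2 * (5 / 4) * (n / 5) := by ring
    have h2 := Real.log_le_sub_one_of_pos (show (0 : ℝ) < 5 / 4 by norm_num)
    have h3 := Real.log_le_sub_one_of_pos (show (0 : ℝ) < n / 5 by positivity)
    have h4 : Real.log n = Real.log 2 + Real.log 2 + Real.log (5 / 4) + Real.log (n / 5) := by
      conv_lhs => rw [h1]
      rw [Real.log_mul (by norm_num) (by positivity), Real.log_mul (by norm_num) (by norm_num),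
        Real.log_mul (by norm_num) (by norm_num)]
    linarith
  have hy19 : 1.9 ≤ y := by
    rw [hy, le_div_iff₀ (by positivity)]
    linarith
  have hly : 0 < Real.log y := Real.log_pos (by linarith)
  have hgoal : 4 * (n : ℝ) /
      (9 * Real.log n * (Real.log n - Real.log (Real.log n) - Real.log 1.5))
      = 2 / 3 * (y / Real.log y) := by
    rw [← hlogy]
    have : 4 * (n : ℝ) / (9 * Real.log n * Real.log y)
      = 2 / 3 * ((2 * (n : ℝ) / (3 * Real.log n)) / Real.log y) := by
      field_simp; norm_num
    rw [this, ← hy]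
  rw [hgoal, gt_iff_lt]
  have hpy : y < Nat.primeCounting n := hy ▸ (h n (by omega)).1
  rcases le_or_gt (Real.exp 1) y with hc | hc
  · have h1 := (h _ hp3).1
    refine lt_of_le_of_lt ?_ h1
    set p : ℝ := (Nat.primeCounting n : ℝ)
    have hp0 : 0 < p := by linarith
    have hlp : 0 < Real.log p := Real.log_pos (by linarith)
    have hm := Real.log_div_self_antitoneOn (show y ∈ {x | Real.exp 1 ≤ x} from hc)
      (show p ∈ {x | Real.exp 1 ≤ x} from hc.trans hpy.le) hpy.le
    have hy0 : 0 < y := by linarith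
    have hm' : y / Real.log y ≤ p / Real.log p := by
      simp only at hm
      rw [div_le_div_iff₀ hp0 hy0] at hm
      rw [div_le_div_iff₀ hly hlp]
      linarith
    have : 2 * p / (3 * Real.log p) = 2 / 3 * (p / Real.log p) := by field_simp
    rw [this]; linarith
  · have he := Real.exp_one_lt_d9
    have hpp2' : (2 : ℝ) ≤ Nat.primeCounting (Nat.primeCounting n) := by exact_mod_cast hpp2
    refine lt_of_lt_of_le ?_ hpp2'
    have hy0 : 0 < y := by linarith
    have h1 := Real.one_sub_inv_le_log_of_pos (show 0 < y / 2 by positivity)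
    rw [Real.log_div hy0.ne' (by norm_num)] at h1
    have h2 : y / 3 < Real.log 2 + 1 - (y / 2)⁻¹ := by
      have : (y / 2)⁻¹ < 1.693 - y / 3 := by
        rw [inv_lt_iff_one_lt_mul₀ (by positivity)]
        nlinarith
      linarith
    have h3 : y / Real.log y < 3 := by
      rw [div_lt_iff₀ hly]; linarith
    linarith
end

section
/- Almost all natural numbers are composite: the quotient π(n)/n tends to 0 as n → ∞; equivalently, π(n) = o(n). -/
open Nat Filter

/-- Almost all natural numbers are composite: `π(n)/n → 0` as `n → ∞`. -/
theorem pi_isLittleO_id :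
    Filter.Tendsto (fun n : ℕ => (Nat.primeCounting n : ℝ) / (n : ℝ))
      Filter.atTop (nhds 0) := by
  have hb := tendsto_natCast_atTop_atTop (R := ℝ) |>.eventually
    (Chebyshev.eventually_primeCounting_le (ε := 1) one_pos)
  have hl : Tendsto (fun n : ℕ => (Real.log 4 + 1) / Real.log (n : ℝ)) atTop (nhds 0) :=
    (Real.tendsto_log_atTop.comp (tendsto_natCast_atTop_atTop (R := ℝ))).const_div_atTop _
  refine squeeze_zero' (Eventually.of_forall fun n => by positivity) ?_ hl
  filter_upwards [hb, eventually_gt_atTop 0] with n hn h0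
  rw [Nat.floor_natCast] at hn
  have h1 : (0 : ℝ) < n := by exact_mod_cast h0
  rw [div_le_iff₀ h1]
  calc _ ≤ _ := hn
    _ = _ := by ring
end

section
/- Mertens-type lower bound: for every natural number n ≥ 2, the product over all primes p ≤ n of (1 − 1/p)⁻¹ is strictly greater than log n. -/
open Nat Finset Real

/-- Mertens-type lower bound: for `n ≥ 2`,
`∏_{p prime, p ≤ n} (1 − 1/p)⁻¹ > log n`. -/
theorem mertens_type_lower_bound (n : ℕ) (hn : 2 ≤ n) :
    Real.log n <
      ∏ p ∈ (Finset.range (n + 1)).filter Nat.Prime, (1 - 1 / (p : ℝ))⁻¹ := by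
  have h1 : Real.log n < Real.log ((n + 1 : ℕ) : ℝ) := by
    apply Real.log_lt_log
    · exact_mod_cast (by omega : 0 < n)
    · exact_mod_cast Nat.lt_succ_self n
  refine (h1.trans_le (log_add_one_le_harmonic n)).trans_le ?_
  rw [harmonic_eq_sum_Icc]
  push_cast
  let f : ℕ →* ℝ :=
    { toFun := fun k => (k : ℝ)⁻¹
      map_one' := by simp
      map_mul' := fun a b => by push_cast; rw [mul_inv] }
  have hf : ∀ {p : ℕ}, p.Prime → ‖f p‖ < 1 := by
    intro p hp
    change ‖(p : ℝ)⁻¹‖ < 1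
    rw [Real.norm_of_nonneg (by positivity)]
    exact inv_lt_one_of_one_lt₀ (by exact_mod_cast hp.one_lt)
  have hs := (EulerProduct.summable_and_hasSum_smoothNumbers_prod_primesBelow_geometric
    hf (n + 1)).2
  have hs2 := (hasSum_subtype_iff_indicator (f := fun m : ℕ => f m)).mp hs
  have h3 := sum_le_hasSum (Finset.Icc 1 n)
    (fun i _ => Set.indicator_nonneg (fun m _ => by
      change 0 ≤ (m : ℝ)⁻¹
      positivity) i) hs2
  have h4 : ∏ p ∈ (Finset.range (n + 1)).filter Nat.Prime, (1 - 1 / (p : ℝ))⁻¹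
      = ∏ p ∈ (n + 1).primesBelow, (1 - f p)⁻¹ := by
    simp only [one_div]
    rfl
  rw [h4]
  refine le_trans (le_of_eq (Finset.sum_congr rfl fun i hi => ?_)) h3
  rw [Finset.mem_Icc] at hi
  rw [Set.indicator_of_mem]
  · rfl
  · exact Nat.mem_smoothNumbers_of_lt (by omega) (by omega)
end

section
/- Sieve upper bound for the prime counting function: for every natural number y ≥ 1 and every natural number r ≥ 1, π(y) < y · ∏_{p prime, p ≤ p_r} (1 − 1/p) + 2^{r+1}. -/
open Nat Finset Real

/-- Numbers in `[1, y]` with no prime divisor in `S`. -/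
def siftedSet (S : Finset ℕ) (y : ℕ) : Finset ℕ :=
  (Finset.Icc 1 y).filter (fun n => ∀ p ∈ S, ¬ p ∣ n)

theorem siftedSet_insert_card (S : Finset ℕ) (q : ℕ) (hq : q.Prime) (hqS : q ∉ S)
    (hS : ∀ p ∈ S, p.Prime) (y : ℕ) :
    (siftedSet (insert q S) y).card + (siftedSet S (y / q)).card = (siftedSet S y).card := by
  have h1 : siftedSet (insert q S) y = (siftedSet S y).filter (fun n => ¬ q ∣ n) := by
    ext n
    simp only [siftedSet, Finset.mem_filter, Finset.mem_insert, forall_eq_or_imp]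
    tauto
  have h2 : (siftedSet S (y / q)).image (fun m => q * m) =
      (siftedSet S y).filter (fun n => q ∣ n) := by
    ext n
    simp only [siftedSet, Finset.mem_filter, Finset.mem_image, Finset.mem_Icc]
    constructor
    · rintro ⟨m, ⟨⟨hm1, hm2⟩, hm⟩, rfl⟩
      refine ⟨⟨⟨Nat.mul_pos hq.pos hm1, ?_⟩, ?_⟩, dvd_mul_right _ _⟩
      · rw [Nat.le_div_iff_mul_le hq.pos] at hm2
        rwa [mul_comm]
      · intro p hp hd
        rcases (hS p hp).dvd_mul.1 hd with h | h
        · rw [Nat.prime_dvd_prime_iff_eq (hS p hp) hq] at h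
          exact hqS (h ▸ hp)
        · exact hm p hp h
    · rintro ⟨⟨⟨hn1, hn2⟩, hn⟩, m, rfl⟩
      refine ⟨m, ⟨⟨Nat.pos_of_mul_pos_left hn1, ?_⟩, ?_⟩, rfl⟩
      · rw [Nat.le_div_iff_mul_le hq.pos, mul_comm]
        exact hn2
      · exact fun p hp hd => hn p hp (hd.mul_left q)
  have h3 : (siftedSet S (y / q)).card = ((siftedSet S y).filter (fun n => q ∣ n)).card := by
    rw [← h2, Finset.card_image_of_injective]
    intro a b h
    exact Nat.eq_of_mul_eq_mul_left hq.pos h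
  rw [h1, h3, add_comm]
  exact Finset.card_filter_add_card_filter_not _

theorem siftedSet_card_bound (S : Finset ℕ) : (∀ p ∈ S, p.Prime) → ∀ y : ℕ,
    |((siftedSet S y).card : ℝ) - y * ∏ p ∈ S, (1 - 1 / (p : ℝ))| ≤ 2 ^ S.card - 1 := by
  induction S using Finset.induction_on with
  | empty => intro _ y; simp [siftedSet]
  | insert q S hqS ih =>
    intro hS y
    have hq : q.Prime := hS q (by simp)
    have hS' : ∀ p ∈ S, p.Prime := fun p hp => hS p (by simp [hp])
    have e : ((siftedSet (insert q S) y).card : ℝ) + (siftedSet S (y / q)).card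
        = (siftedSet S y).card := by
      exact_mod_cast siftedSet_insert_card S q hq hqS hS' y
    have i1 := abs_le.1 (ih hS' y)
    have i2 := abs_le.1 (ih hS' (y / q))
    rw [Finset.prod_insert hqS, Finset.card_insert_of_notMem hqS, pow_succ]
    have hpq : ∀ p ∈ S, (0:ℝ) ≤ 1 - 1 / (p:ℝ) ∧ 1 - 1 / (p:ℝ) ≤ 1 := by
      intro p hp
      have : (1:ℝ) ≤ p := by exact_mod_cast (hS' p hp).one_lt.le
      have h0 : 1 / (p:ℝ) ≤ 1 := by rw [div_le_one (by linarith)]; exact this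
      have h1 : 0 ≤ 1 / (p:ℝ) := by positivity
      constructor <;> linarith
    have hP0 : 0 ≤ ∏ p ∈ S, (1 - 1 / (p : ℝ)) := Finset.prod_nonneg fun p hp => (hpq p hp).1
    have hP1 : ∏ p ∈ S, (1 - 1 / (p : ℝ)) ≤ 1 :=
      Finset.prod_le_one (fun p hp => (hpq p hp).1) fun p hp => (hpq p hp).2
    generalize (∏ p ∈ S, (1 - 1 / (p : ℝ))) = P at *
    have hd1 : ((y / q : ℕ) : ℝ) ≤ (y:ℝ) / q := Nat.cast_div_le
    have hd2 : (y:ℝ) / q ≤ ((y / q : ℕ) : ℝ) + 1 := by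
      have hq0 : (0:ℝ) < q := by exact_mod_cast hq.pos
      rw [div_le_iff₀ hq0]
      have := (Nat.lt_mul_div_succ y hq.pos).le
      have h : (y:ℝ) ≤ q * ((y / q : ℕ) + 1) := by exact_mod_cast this
      linarith
    have hy : (y:ℝ) * ((1 - 1 / (q:ℝ)) * P) = y * P - (y / q) * P := by ring
    rw [hy, abs_le]
    have k1 : ((y / q : ℕ) : ℝ) * P ≤ (y:ℝ) / q * P := mul_le_mul_of_nonneg_right hd1 hP0
    have k2 : (y:ℝ) / q * P ≤ (((y / q : ℕ) : ℝ) + 1) * P := mul_le_mul_of_nonneg_right hd2 hP0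
    constructor <;> linarith [i1.1, i1.2, i2.1, i2.2]

/-- Sieve upper bound: for `y ≥ 1` and `r ≥ 1`,
`π(y) < y · ∏_{p prime, p ≤ p_r} (1 − 1/p) + 2^(r+1)`, where `p_r` is the
`r`-th prime (`p₁ = 2`). -/
theorem primeCounting_sieve_upper_bound (y r : ℕ) (hy : 1 ≤ y) (hr : 1 ≤ r) :
    (Nat.primeCounting y : ℝ) <
      (y : ℝ) *
        ∏ p ∈ (Finset.range (Nat.nth Nat.Prime (r - 1) + 1)).filter Nat.Prime,
          (1 - 1 / (p : ℝ)) + 2 ^ (r + 1) := by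
  have hcard : ((Finset.range (Nat.nth Nat.Prime (r - 1) + 1)).filter Nat.Prime).card = r := by
    rw [← Nat.count_eq_card_filter_range, Nat.count_nth_succ_of_infinite Nat.infinite_setOf_prime]
    omega
  have hS : ∀ p ∈ (Finset.range (Nat.nth Nat.Prime (r - 1) + 1)).filter Nat.Prime, p.Prime :=
    fun p hp => (Finset.mem_filter.1 hp).2
  have hb := (abs_le.1 (siftedSet_card_bound _ hS y)).2
  generalize hT : (Finset.range (Nat.nth Nat.Prime (r - 1) + 1)).filter Nat.Prime = S at *
  have hpi : Nat.primeCounting y ≤ S.card + (siftedSet S y).card := by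
    rw [← Nat.primesLE_card_eq_primeCounting]
    refine (Finset.card_le_card ?_).trans (Finset.card_union_le _ _)
    intro n hn
    rw [Nat.mem_primesLE] at hn
    rw [Finset.mem_union]
    by_cases h : n ∈ S
    · exact Or.inl h
    · right
      simp only [siftedSet, Finset.mem_filter, Finset.mem_Icc]
      refine ⟨⟨hn.2.pos, hn.1⟩, fun p hp hd => h ?_⟩
      rw [Nat.prime_dvd_prime_iff_eq (hS p hp) hn.2] at hd
      exact hd ▸ hp
  rw [hcard] at hb hpi
  have h1 : (Nat.primeCounting y : ℝ) ≤ r + (siftedSet S y).card := by exact_mod_cast hpi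
  have h2 : (r : ℝ) < 2 ^ r := by exact_mod_cast Nat.lt_two_pow_self
  rw [pow_succ]
  linarith
end

section
/- For every natural number y ≥ 1 and every natural number r ≥ 2, π(y) < y / log r + 2^{r+1}. -/
open Nat Real

/-- Legendre sieve with an explicit error term. -/
lemma sieve_aux (S : Finset ℕ) (hS : ∀ p ∈ S, p.Prime) : ∀ x : ℝ, 0 ≤ x →
    |(((Finset.Icc 1 ⌊x⌋₊).filter (fun n => ∀ p ∈ S, ¬ p ∣ n)).card : ℝ)
      - x * ∏ p ∈ S, (1 - (p : ℝ)⁻¹)| ≤ 2 ^ S.card := by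
  induction S using Finset.induction_on with
  | empty =>
    intro x hx
    simp only [Finset.notMem_empty, false_implies, implies_true, Finset.filter_true,
      Nat.card_Icc, Finset.prod_empty, Finset.card_empty, pow_zero, mul_one,
      Nat.add_sub_cancel]
    rw [abs_le]
    constructor
    · linarith [Nat.lt_floor_add_one x]
    · linarith [Nat.floor_le hx]
  | insert q S hq ih =>
    intro x hx
    have hS' : ∀ p ∈ S, p.Prime := fun p hp => hS p (Finset.mem_insert_of_mem hp)
    have hqp : q.Prime := hS q (Finset.mem_insert_self _ _)
    have h1 := ih hS' x hx
    have h2 := ih hS' (x / q) (by positivity)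
    have key : ((Finset.Icc 1 ⌊x⌋₊).filter (fun n => ∀ p ∈ S, ¬ p ∣ n)).card =
        ((Finset.Icc 1 ⌊x⌋₊).filter (fun n => ∀ p ∈ insert q S, ¬ p ∣ n)).card +
        ((Finset.Icc 1 ⌊x / q⌋₊).filter (fun n => ∀ p ∈ S, ¬ p ∣ n)).card := by
      have himg : ((Finset.Icc 1 ⌊x / q⌋₊).filter (fun n => ∀ p ∈ S, ¬ p ∣ n)).card =
          (((Finset.Icc 1 ⌊x⌋₊).filter (fun n => ∀ p ∈ S, ¬ p ∣ n)).filter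
            (fun n => q ∣ n)).card := by
        rw [Nat.floor_div_natCast]
        refine Finset.card_bij (fun m _ => q * m) ?_ ?_ ?_
        · intro m hm
          simp only [Finset.mem_filter, Finset.mem_Icc] at hm ⊢
          obtain ⟨⟨hm1, hm2⟩, hm3⟩ := hm
          refine ⟨⟨⟨Nat.mul_pos hqp.pos hm1, ?_⟩, ?_⟩, dvd_mul_right _ _⟩
          · rw [Nat.le_div_iff_mul_le hqp.pos] at hm2
            linarith
          · intro p hp hd
            rcases ((hS' p hp).dvd_mul).1 hd with h | h
            · rw [(Nat.prime_dvd_prime_iff_eq (hS' p hp) hqp).1 h] at hp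
              exact hq hp
            · exact hm3 p hp h
        · intro a _ b _ h
          exact Nat.eq_of_mul_eq_mul_left hqp.pos h
        · intro n hn
          simp only [Finset.mem_filter, Finset.mem_Icc] at hn
          obtain ⟨⟨⟨hn1, hn2⟩, hn3⟩, m, rfl⟩ := hn
          refine ⟨m, ?_, rfl⟩
          simp only [Finset.mem_filter, Finset.mem_Icc]
          refine ⟨⟨Nat.pos_of_mul_pos_left hn1, ?_⟩, ?_⟩
          · rw [Nat.le_div_iff_mul_le hqp.pos]
            linarith
          · intro p hp hd
            exact hn3 p hp (dvd_mul_of_dvd_right hd _)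
      rw [himg, ← Finset.card_filter_add_card_filter_not (fun n => q ∣ n), add_comm]
      congr 2
      ext n
      simp only [Finset.mem_filter, Finset.mem_insert, forall_eq_or_imp]
      tauto
    have key' : (((Finset.Icc 1 ⌊x⌋₊).filter (fun n => ∀ p ∈ S, ¬ p ∣ n)).card : ℝ) =
        ((Finset.Icc 1 ⌊x⌋₊).filter (fun n => ∀ p ∈ insert q S, ¬ p ∣ n)).card +
        ((Finset.Icc 1 ⌊x / q⌋₊).filter (fun n => ∀ p ∈ S, ¬ p ∣ n)).card := by
      exact_mod_cast key
    rw [Finset.prod_insert hq, Finset.card_insert_of_notMem hq, pow_succ]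
    have e : x * ((1 - (q : ℝ)⁻¹) * ∏ p ∈ S, (1 - (p : ℝ)⁻¹)) =
      x * ∏ p ∈ S, (1 - (p : ℝ)⁻¹) - x / q * ∏ p ∈ S, (1 - (p : ℝ)⁻¹) := by
      rw [div_eq_mul_inv]; ring
    rw [e]
    rw [abs_le] at h1 h2 ⊢
    constructor <;> linarith [h1.1, h1.2, h2.1, h2.2]

/-- The reciprocal, as a completely multiplicative function. -/
noncomputable def recipHom : ℕ →* ℝ where
  toFun n := (n : ℝ)⁻¹
  map_one' := by simp
  map_mul' a b := by simp [mul_comm]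

lemma mertens_aux (r : ℕ) (hr : 1 ≤ r) :
    Real.log r ≤ ∏ p ∈ Nat.primesBelow (r + 1), (1 - (p : ℝ)⁻¹)⁻¹ := by
  have h := EulerProduct.summable_and_hasSum_smoothNumbers_prod_primesBelow_geometric
    (f := recipHom) (fun {p} hp => by
      change ‖((p : ℝ))⁻¹‖ < 1
      rw [norm_inv, Real.norm_natCast]
      exact inv_lt_one_of_one_lt₀ (by exact_mod_cast hp.one_lt)) (r + 1)
  have h2 := h.2
  have hlog : Real.log r ≤ (harmonic r : ℝ) :=
    (Real.log_le_log (by exact_mod_cast hr) (by push_cast; linarith)).trans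
      (log_add_one_le_harmonic r)
  refine hlog.trans ?_
  have h3 : ∏ p ∈ Nat.primesBelow (r + 1), (1 - (p : ℝ)⁻¹)⁻¹ =
    ∑' m : Nat.smoothNumbers (r + 1), ((m : ℕ) : ℝ)⁻¹ := h2.tsum_eq.symm
  rw [h3]
  have hs : Summable (fun m : Nat.smoothNumbers (r + 1) => ((m : ℕ) : ℝ)⁻¹) := h2.summable
  have hmem : ∀ i ∈ Finset.range r, i + 1 ∈ Nat.smoothNumbers (r + 1) := by
    intro i hi
    have := Finset.mem_range.1 hi
    exact Nat.mem_smoothNumbers_of_lt (by omega) (by omega)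
  let g : {i // i ∈ Finset.range r} ↪ Nat.smoothNumbers (r + 1) :=
    ⟨fun i => ⟨i.1 + 1, hmem i.1 i.2⟩, fun a b hab => by
      apply Subtype.ext
      have := congrArg Subtype.val hab
      simpa using this⟩
  have h4 := hs.sum_le_tsum ((Finset.range r).attach.map g) (fun i _ => by positivity)
  refine le_trans (le_of_eq ?_) h4
  rw [Finset.sum_map, harmonic]
  push_cast
  rw [← Finset.sum_attach]
  refine Finset.sum_congr rfl fun i _ => ?_
  change _ = (((i.1 + 1 : ℕ)) : ℝ)⁻¹
  push_cast
  rfl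

/-- For `y ≥ 1` and `r ≥ 2`, `π(y) < y / log r + 2^(r+1)`. -/
theorem primeCounting_lt_div_log_add (y r : ℕ) (hy : 1 ≤ y) (hr : 2 ≤ r) :
    (Nat.primeCounting y : ℝ) < (y : ℝ) / Real.log r + 2 ^ (r + 1) := by
  have hlog : 0 < Real.log r := Real.log_pos (by exact_mod_cast hr)
  have hm := mertens_aux r (by omega)
  set S := Nat.primesBelow (r + 1) with hS
  have hcard : S.card ≤ r := by
    have : S ⊆ Finset.Icc 1 r := by
      intro p hp
      have h1 := (Nat.prime_of_mem_primesBelow hp).one_lt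
      have h2 := Nat.lt_of_mem_primesBelow hp
      simp; omega
    simpa using Finset.card_le_card this
  have hs := (abs_le.1 (sieve_aux S (fun p hp => Nat.prime_of_mem_primesBelow hp) y
    (by positivity))).2
  rw [Nat.floor_natCast] at hs
  have hpi : Nat.primeCounting y ≤
      S.card + ((Finset.Icc 1 y).filter (fun n => ∀ p ∈ S, ¬ p ∣ n)).card := by
    rw [← Nat.primesLE_card_eq_primeCounting]
    refine (Finset.card_le_card ?_).trans (Finset.card_union_le _ _)
    intro q hq
    obtain ⟨hqy, hqp⟩ := Nat.mem_primesLE.1 hq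
    rw [Finset.mem_union]
    by_cases h : q ∈ S
    · exact Or.inl h
    · right
      rw [Finset.mem_filter, Finset.mem_Icc]
      refine ⟨⟨hqp.pos, hqy⟩, fun p hp hd => h ?_⟩
      rwa [← (Nat.prime_dvd_prime_iff_eq (Nat.prime_of_mem_primesBelow hp) hqp).1 hd]
  have hpi' : (Nat.primeCounting y : ℝ) ≤
      S.card + ((Finset.Icc 1 y).filter (fun n => ∀ p ∈ S, ¬ p ∣ n)).card := by
    exact_mod_cast hpi
  have hprod : ∏ p ∈ S, (1 - (p : ℝ)⁻¹) ≤ (Real.log r)⁻¹ := by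
    rw [Finset.prod_inv_distrib] at hm
    exact le_inv_of_le_inv₀ hlog hm
  have hmul : (y : ℝ) * ∏ p ∈ S, (1 - (p : ℝ)⁻¹) ≤ y / Real.log r := by
    rw [div_eq_mul_inv]
    exact mul_le_mul_of_nonneg_left hprod (by positivity)
  have hpow : (2 : ℝ) ^ S.card ≤ 2 ^ r := pow_le_pow_right₀ (by norm_num) hcard
  have hr2 : (S.card : ℝ) < 2 ^ r := by
    exact_mod_cast lt_of_le_of_lt hcard Nat.lt_two_pow_self
  rw [pow_succ]
  linarith
end
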